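/- Let K = ℚ(√13) be the real quadratic field generated by a root √13 of x² − 13, let P(X) = (X² + 5X + 13)·(X⁴ + 7X³ + 20X² + 19X + 1)³ ∈ K[X], and let j = (4096000/1594323)·(15996230 + 4436419·√13) ∈ K. Then the Galois group over K of the polynomial F(X) = P(X) − jX (the Galois group of its splitting field over K) is isomorphic to the alternating group A₄. -/

import Mathlib

open Polynomial IntermediateField

/-- The real quadratic field `K = ℚ(√13)`, generated over `ℚ` by the root `√13 ∈ ℝ`
of `x² − 13`. -/
noncomputable def K13 : IntermediateField ℚ ℝ := ℚ⟮Real.sqrt 13⟯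

/-- The element `√13` of `K = ℚ(√13)`. -/
noncomputable def sqrt13 : K13 := AdjoinSimple.gen ℚ (Real.sqrt 13)

/-- The polynomial `P(X) = (X² + 5X + 13)·(X⁴ + 7X³ + 20X² + 19X + 1)³` over `K = ℚ(√13)`. -/
noncomputable def P13 : Polynomial K13 :=
  (X ^ 2 + 5 * X + 13) * (X ^ 4 + 7 * X ^ 3 + 20 * X ^ 2 + 19 * X + 1) ^ 3

/-- The `j`-invariant `j = (4096000/1594323)·(15996230 + 4436419·√13) ∈ ℚ(√13)`. -/
noncomputable def j14 : K13 := (4096000 / 1594323 : K13) * (15996230 + 4436419 * sqrt13)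

/-- `F(X) = P(X) − j·X` over `K = ℚ(√13)`. -/
noncomputable def F14 : Polynomial K13 := P13 - C j14 * X

/-- A root of the second quartic factor generates the same field as a root of the first one. -/
theorem exists_quartic_root_of_quartic_root {L : Type*} [Field L] [CharZero L] {s x : L}
    (hs : s ^ 2 = 13)
    (hx : x ^ 4 + ((43 + 5 * s) / 6) * x ^ 3 + ((116 + 28 * s) / 3) * x ^ 2 +
        ((1073 + 298 * s) / 9) * x + ((48607 + 13481 * s) / 162) = 0) :
    ∃ y : L, y ^ 4 + 11 * y ^ 3 + ((436 - 16 * s) / 9) * y ^ 2 + ((3529 - 40 * s) / 27) * y +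
        (269 + 32 * s) = 0 ∧
      ((-299 + 361 * s) / 9360) * y ^ 3 + ((-1703 + 955 * s) / 2340) * y ^ 2 +
          ((-3796 + 1799 * s) / 1170) * y + ((-49049 + 27835 * s) / 9360) = x := by
  obtain ⟨y, hy⟩ : ∃ y : L, y =
      ((899 - 247 * s) / 80) * x ^ 3 + ((933 - 255 * s) / 20) * x ^ 2 + ((580 - 151 * s) / 10) * x +
          ((-103 + 67 * s) / 80) := ⟨_, rfl⟩
  have h2 : y ^ 2 =
      ((-4549 + 1247 * s) / 80) * x ^ 3 + ((-2369 + 640 * s) / 10) * x ^ 2 +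
          ((-17945 + 4481 * s) / 60) * x + ((-17123 - 6703 * s) / 720) := by
    linear_combination y * hy + (((899 - 247 * s) / 80) * x ^ 3 + ((933 - 255 * s) / 20) * x ^ 2 +
        ((580 - 151 * s) / 10) * x + ((-103 + 67 * s) / 80)) * hy
      + (((800659 - 222053 * s) / 3200) * x ^ 2 + ((1648903 - 457310 * s) / 1600) * x +
          ((4034483 - 1118875 * s) / 3200)) * hx
      + ((61009 / 6400) * x ^ 6 + (524381 / 3840) * x ^ 5 + (1826627 / 1600) * x ^ 4 +
          (324663871 / 57600) * x ^ 3 + (9698386477 / 518400) * x ^ 2 + (2289815761 / 64800) * x +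
          (3770979371 / 129600)) * hs
  have h3 : y ^ 3 =
      ((1534 - 419 * s) / 10) * x ^ 3 + ((9619 - 2551 * s) / 15) * x ^ 2 +
          ((12487 - 2881 * s) / 15) * x + ((42118 + 11519 * s) / 270) := by
    linear_combination y * h2 + (((-4549 + 1247 * s) / 80) * x ^ 3 +
        ((-2369 + 640 * s) / 10) * x ^ 2 + ((-17945 + 4481 * s) / 60) * x +
        ((-17123 - 6703 * s) / 720)) * hy
      + (((-2023417 + 561164 * s) / 1600) * x ^ 2 + ((-16651371 + 4617915 * s) / 3200) * x +
          ((-20393323 + 5655485 * s) / 3200)) * hx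
      + (((-308009) / 6400) * x ^ 6 + ((-661069) / 960) * x ^ 5 + ((-110553499) / 19200) * x ^ 4 +
          ((-1637653981) / 57600) * x ^ 3 + ((-6118372819) / 64800) * x ^ 2 +
          ((-30828278041) / 172800) * x + ((-38122817597) / 259200)) * hs
  have h4 : y ^ 4 =
      ((-24175 + 5971 * s) / 240) * x ^ 3 + ((-26473 + 5083 * s) / 60) * x ^ 2 +
          ((-73244 + 2033 * s) / 90) * x + ((-5595887 - 1321525 * s) / 6480) := by
    linear_combination y ^ 2 * h2 + (((-4549 + 1247 * s) / 80) * x ^ 3 +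
        ((-2369 + 640 * s) / 10) * x ^ 2 + ((-17945 + 4481 * s) / 60) * x +
        ((-17123 - 6703 * s) / 720)) * h2
      + (((20454259 - 5672603 * s) / 3200) * x ^ 2 + ((84077311 - 23315585 * s) / 3200) * x +
          ((51544869 - 14292360 * s) / 1600)) * hx
      + ((1555009 / 6400) * x ^ 6 + (13334171 / 3840) * x ^ 5 + (557589349 / 19200) * x ^ 4 +
          (1376761411 / 9600) * x ^ 3 + (247030935127 / 518400) * x ^ 2 +
          (466924972033 / 518400) * x + (385395540529 / 518400)) * hs
  refine ⟨y, ?_, ?_⟩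
  · linear_combination h4 + 11 * h3 + ((436 - 16 * s) / 9) * h2 + ((3529 - 40 * s) / 27) * hy
      + (((-6247) / 270) * x ^ 3 + ((-854) / 9) * x ^ 2 + ((-552) / 5) * x + (12401 / 810)) * hs
  · linear_combination ((-299 + 361 * s) / 9360) * h3 + ((-1703 + 955 * s) / 2340) * h2 +
        ((-3796 + 1799 * s) / 1170) * hy
      + (((-113) / 62400) * x ^ 3 + ((-6181) / 140400) * x ^ 2 + ((-10237) / 70200) * x +
          ((-67363) / 77760)) * hs

/-- A root `x` of the sextic factor generates the field of some `w` such that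
`w ^ 2 / 4 - a ^ 2 / 4 + b` is a root of the resolvent cubic of `X ^ 4 + a X ^ 3 + b X ^ 2 + ⋯`. -/
theorem exists_resolvent_root_of_sextic_root {L : Type*} [Field L] [CharZero L] {s x : L}
    (hs : s ^ 2 = 13)
    (hx : x ^ 6 + ((47 - 5 * s) / 6) * x ^ 5 + ((232 - 73 * s) / 9) * x ^ 4 +
        ((2465 - 1553 * s) / 54) * x ^ 3 + ((38419 + 935 * s) / 162) * x ^ 2 +
        ((-27374 - 16423 * s) / 243) * x + ((17743 - 4921 * s) / 1458) = 0) :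
    ∃ w θ : L, w ^ 2 = 121 - 4 * ((436 - 16 * s) / 9) + 4 * θ ∧
      θ ^ 3 + ((-436 + 16 * s) / 9) * θ ^ 2 + ((9767 - 3896 * s) / 27) * θ +
          ((-359390 + 585584 * s) / 729) = 0 ∧
      ((3619538 - 1002721 * s) / 200689920) * w ^ 5 + ((4147 - 1214 * s) / 449280) * w ^ 4 +
          ((45493226 - 12608851 * s) / 33448320) * w ^ 3 + ((4333 - 1118 * s) / 5760) * w ^ 2 +
          ((-233620814 + 43063507 * s) / 200689920) * w + ((19763 + 21866 * s) / 34560) = x := by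
  obtain ⟨w, hw⟩ : ∃ w : L, w =
      ((1859 + 587 * s) / 56160) * x ^ 5 + ((1313 - 4 * s) / 3120) * x ^ 4 +
          ((91559 - 22663 * s) / 56160) * x ^ 3 + ((192829 - 111539 * s) / 56160) * x ^ 2 +
          ((9787 + 106 * s) / 720) * x + ((-204659 - 121109 * s) / 56160) := ⟨_, rfl⟩
  have h2 : w ^ 2 =
      ((-7657 + 1997 * s) / 7020) * x ^ 5 + ((-3601 + 1049 * s) / 390) * x ^ 4 +
          ((-247897 + 78917 * s) / 7020) * x ^ 3 + ((-467831 + 149347 * s) / 7020) * x ^ 2 +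
          ((-82043 + 9043 * s) / 1170) * x + ((393289 + 144823 * s) / 7020) := by
    linear_combination w * hw + (((1859 + 587 * s) / 56160) * x ^ 5 +
        ((1313 - 4 * s) / 3120) * x ^ 4 + ((91559 - 22663 * s) / 56160) * x ^ 3 +
        ((192829 - 111539 * s) / 56160) * x ^ 2 + ((9787 + 106 * s) / 720) * x +
        ((-204659 - 121109 * s) / 56160)) * hw
      + (((305203 + 83941 * s) / 121305600) * x ^ 4 + ((928001 + 326834 * s) / 60652800) * x ^ 3 +
          ((925127 - 156217 * s) / 7581600) * x ^ 2 + ((25693441 - 13887521 * s) / 121305600) * x +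
          ((67997777 - 5625340 * s) / 60652800)) * hx
      + ((344569 / 3153945600) * x ^ 10 + (5202581 / 9461836800) * x ^ 9 +
          (11843669 / 7096377600) * x ^ 8 + (507029843 / 85156531200) * x ^ 7 +
          (15191592019 / 255469593600) * x ^ 6 + ((-2423665979) / 95801097600) * x ^ 5 +
          (625326428443 / 2299226342400) * x ^ 4 + ((-5116356900179) / 2299226342400) * x ^ 3 +
          (756521488781 / 574806585600) * x ^ 2 + ((-1289262919073) / 176863564800) * x +
          (9972787471609 / 2299226342400)) * hs
  have h3 : w ^ 3 =
      ((29539 + 859 * s) / 4320) * x ^ 5 + ((24715 + 1732 * s) / 720) * x ^ 4 +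
          ((139159 - 11831 * s) / 4320) * x ^ 3 + ((-1060387 - 149059 * s) / 4320) * x ^ 2 +
          ((188797 + 62502 * s) / 240) * x + ((-3292131 - 871205 * s) / 4320) := by
    linear_combination w * h2 + (((-7657 + 1997 * s) / 7020) * x ^ 5 +
        ((-3601 + 1049 * s) / 390) * x ^ 4 + ((-247897 + 78917 * s) / 7020) * x ^ 3 +
        ((-467831 + 149347 * s) / 7020) * x ^ 2 + ((-82043 + 9043 * s) / 1170) * x +
        ((393289 + 144823 * s) / 7020)) * hw
      + (((19322 - 15043 * s) / 7581600) * x ^ 4 + ((-3376684 + 995513 * s) / 7581600) * x ^ 3 +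
          ((-8363167 + 2740139 * s) / 3790800) * x ^ 2 + ((-38185672 +
          12918629 * s) / 7581600) * x + ((-12739840 + 71 * s) / 7581600)) * hx
      + ((1172239 / 394243200) * x ^ 10 + (1543213 / 59136480) * x ^ 9 +
          (164253859 / 1774094400) * x ^ 8 + (893510491 / 5322283200) * x ^ 7 +
          (41114387863 / 31933699200) * x ^ 6 + (8362208269 / 2993784300) * x ^ 5 +
          (1194417129391 / 287403292800) * x ^ 4 + ((-765196249147) / 143701646400) * x ^ 3 +
          (352465968121 / 11053972800) * x ^ 2 + ((-11321922073) / 1437016464) * x +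
          ((-12786190703237) / 287403292800)) * hs
  have h4 : w ^ 4 =
      ((6979 - 2063 * s) / 90) * x ^ 5 + ((3703 - 959 * s) / 5) * x ^ 4 +
          ((282619 - 64703 * s) / 90) * x ^ 3 + ((539389 - 120609 * s) / 90) * x ^ 2 +
          ((184109 - 225893 * s) / 135) * x + ((2491033 + 582593 * s) / 270) := by
    linear_combination w ^ 2 * h2 + (((-7657 + 1997 * s) / 7020) * x ^ 5 +
        ((-3601 + 1049 * s) / 390) * x ^ 4 + ((-247897 + 78917 * s) / 7020) * x ^ 3 +
        ((-467831 + 149347 * s) / 7020) * x ^ 2 + ((-82043 + 9043 * s) / 1170) * x +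
        ((393289 + 144823 * s) / 7020)) * h2
      + (((4248991 - 1176233 * s) / 1895400) * x ^ 4 + ((29858869 -
          8323889 * s) / 1895400) * x ^ 3 + ((85838099 - 23837659 * s) / 1895400) * x ^ 2 +
          ((88163527 - 22461707 * s) / 1895400) * x + ((-13147471 + 8331440 * s) / 947700)) * hx
      + ((3988009 / 49280400) * x ^ 10 + (149788979 / 147841200) * x ^ 9 +
          (2189871209 / 443523600) * x ^ 8 + (717690134 / 83160675) * x ^ 7 +
          (21188317799 / 1995856200) * x ^ 6 + (386540184583 / 5987568600) * x ^ 5 +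
          (4338672604943 / 17962705800) * x ^ 4 + (1118728269281 / 4490676450) * x ^ 3 +
          (1559919054689 / 35925411600) * x ^ 2 + (31364788155781 / 35925411600) * x +
          (16355802691081 / 35925411600)) * hs
  have h5 : w ^ 5 =
      ((1220423 + 890831 * s) / 4320) * x ^ 5 + ((160191 + 86660 * s) / 80) * x ^ 4 +
          ((-749317 + 3351461 * s) / 4320) * x ^ 3 + ((-86952263 - 35831063 * s) / 4320) * x ^ 2 +
          ((774631003 + 192785546 * s) / 6480) * x + ((-3719201935 - 1062616601 * s) / 38880) := by
    linear_combination w ^ 2 * h3 + (((29539 + 859 * s) / 4320) * x ^ 5 +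
        ((24715 + 1732 * s) / 720) * x ^ 4 + ((139159 - 11831 * s) / 4320) * x ^ 3 +
        ((-1060387 - 149059 * s) / 4320) * x ^ 2 + ((188797 + 62502 * s) / 240) * x +
        ((-3292131 - 871205 * s) / 4320)) * h2
      + (((-50969906 + 13103005 * s) / 7581600) * x ^ 4 + ((-101154872 +
          34544953 * s) / 7581600) * x ^ 3 + ((71695039 + 23594029 * s) / 3790800) * x ^ 2 +
          ((1382302324 - 136512131 * s) / 7581600) * x + ((-999750752 -
          83570261 * s) / 7581600)) * hx
      + ((1715423 / 30326400) * x ^ 10 + (60486859 / 22744800) * x ^ 9 +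
          (702589051 / 27293760) * x ^ 8 + (43372084211 / 409406400) * x ^ 7 +
          (392405871071 / 2456438400) * x ^ 6 + (153798227203 / 460582200) * x ^ 5 +
          (29850276891767 / 22107945600) * x ^ 4 + (7015006859177 / 2210794560) * x ^ 3 +
          ((-45560587586503) / 11053972800) * x ^ 2 + (4156487778179 / 1381746600) * x +
          ((-92800808838997) / 22107945600)) * hs
  have h6 : w ^ 6 =
      ((-3533491 + 845375 * s) / 540) * x ^ 5 + ((-4599257 + 1444289 * s) / 90) * x ^ 4 +
          ((-97283251 + 38338775 * s) / 540) * x ^ 3 + ((-546437255 +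
          218502323 * s) / 1620) * x ^ 2 + ((-1437191483 - 19307725 * s) / 2430) * x +
          ((5121727507 + 1568759333 * s) / 4860) := by
    linear_combination w ^ 3 * h3 + (((29539 + 859 * s) / 4320) * x ^ 5 +
        ((24715 + 1732 * s) / 720) * x ^ 4 + ((139159 - 11831 * s) / 4320) * x ^ 3 +
        ((-1060387 - 149059 * s) / 4320) * x ^ 2 + ((188797 + 62502 * s) / 240) * x +
        ((-3292131 - 871205 * s) / 4320)) * h3
      + (((441072487 + 25374001 * s) / 9331200) * x ^ 4 + ((658101485 +
          301573898 * s) / 4665600) * x ^ 3 + ((200309075 + 37923251 * s) / 583200) * x ^ 2 +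
          ((-13459545155 - 1049764157 * s) / 9331200) * x + ((40246602941 +
          5250108212 * s) / 4665600)) * hx
      + ((737881 / 18662400) * x ^ 10 + (180430373 / 55987200) * x ^ 9 +
          (677041657 / 8398080) * x ^ 8 + (317335869539 / 503884800) * x ^ 7 +
          (3358875272851 / 1511654400) * x ^ 6 + (347806158497 / 113374080) * x ^ 5 +
          (118200591188827 / 13604889600) * x ^ 4 + (282402618939421 / 13604889600) * x ^ 3 +
          (230805469432901 / 3401222400) * x ^ 2 + ((-15981411699461) / 544195584) * x +
          (604981217848729 / 13604889600)) * hs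
  refine ⟨w, w ^ 2 / 4 - 121 / 4 + ((436 - 16 * s) / 9), by ring, ?_, ?_⟩
  · linear_combination (1 / 64) * h6 + ((221 - 128 * s) / 576) * h4 +
        ((-475501 - 131456 * s) / 5184) * h2
      + (((-46361) / 21870) * x ^ 5 + ((-6217) / 243) * x ^ 4 + ((-2740481) / 21870) * x ^ 3 +
          ((-5285527) / 21870) * x ^ 2 + (640961 / 3645) * x + ((-21927691) / 21870)) * hs
      + ((64 / 81) * w ^ 2 + (39104 / 243)) * hs
  · linear_combination ((3619538 - 1002721 * s) / 200689920) * h5 +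
        ((4147 - 1214 * s) / 449280) * h4 + ((45493226 - 12608851 * s) / 33448320) * h3
      + ((4333 - 1118 * s) / 5760) * h2 + ((-233620814 + 43063507 * s) / 200689920) * hw
      + (((-953401531) / 869656320) * x ^ 5 + ((-41242658021) / 6522422400) * x ^ 4 +
          ((-74428992761) / 23480720640) * x ^ 3 + (6282686513773 / 117403603200) * x ^ 2 +
          ((-25756962540521) / 105663242880) * x + (641201914550827 / 3169897286400)) * hs

theorem eval_factorization {L : Type*} [Field L] [CharZero L] {s : L} (hs : s ^ 2 = 13) (x : L) :
    (x ^ 2 + 5 * x + 13) * (x ^ 4 + 7 * x ^ 3 + 20 * x ^ 2 + 19 * x + 1) ^ 3 -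
        4096000 / 1594323 * (15996230 + 4436419 * s) * x =
      (x ^ 4 + 11 * x ^ 3 + ((436 - 16 * s) / 9) * x ^ 2 + ((3529 - 40 * s) / 27) * x +
          (269 + 32 * s)) *
      ((x ^ 4 + ((43 + 5 * s) / 6) * x ^ 3 + ((116 + 28 * s) / 3) * x ^ 2 +
          ((1073 + 298 * s) / 9) * x + ((48607 + 13481 * s) / 162)) *
      (x ^ 6 + ((47 - 5 * s) / 6) * x ^ 5 + ((232 - 73 * s) / 9) * x ^ 4 +
          ((2465 - 1553 * s) / 54) * x ^ 3 + ((38419 + 935 * s) / 162) * x ^ 2 +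
          ((-27374 - 16423 * s) / 243) * x + ((17743 - 4921 * s) / 1458))) := by
  linear_combination (-1) *
    (((-25) / 36) * x ^ 12 + ((-2395) / 108) * x ^ 11 + ((-104967 + 400 * s) / 324) * x ^ 10 +
        ((-683881 + 6530 * s) / 243) * x ^ 9 + ((-48021681 + 657728 * s) / 2916) * x ^ 8 +
        ((-610447465 + 6934792 * s) / 8748) * x ^ 7 + ((-2933740597 -
        3727208 * s) / 13122) * x ^ 6 + ((-42860208257 - 928499008 * s) / 78732) * x ^ 5 +
        ((-233247547133 - 10574058784 * s) / 236196) * x ^ 4 +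
        ((-73114066285 - 4599670634 * s) / 59049) * x ^ 3 + ((-210550720723 -
        11396754944 * s) / 236196) * x ^ 2 + ((-16125112038363 - 1167882386968 * s) / 6377292) * x +
        ((-17845513517 - 2122880032 * s) / 236196)) * hs

theorem Subgroup.eq_alternatingGroup_of_three_dvd_card (H : Subgroup (Equiv.Perm (Fin 4)))
    (hle : H ≤ alternatingGroup (Fin 4)) (h3 : 3 ∣ Nat.card H)
    (hfix : ∀ i, ∃ σ ∈ H, σ i ≠ i) : H = alternatingGroup (Fin 4) := by
  set N : Subgroup (alternatingGroup (Fin 4)) := H.subgroupOf (alternatingGroup (Fin 4)) with hN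
  have hcard : Nat.card N = Nat.card H := Nat.card_congr (Subgroup.subgroupOfEquivOfLe hle).toEquiv
  have hA : Nat.card (alternatingGroup (Fin 4)) = 12 := by
    rw [Nat.card_eq_fintype_card]; decide
  have hmul := N.card_mul_index
  rw [hA, hcard] at hmul
  have hne3 : Nat.card H ≠ 3 := by
    intro h
    have hp : IsPGroup 3 H := IsPGroup.of_card (n := 1) (by simpa using h)
    have : Fact (Nat.Prime 3) := ⟨by norm_num⟩
    obtain ⟨i, hi⟩ := hp.nonempty_fixed_point_of_prime_not_dvd_card (Fin 4)
      (by rw [Nat.card_eq_fintype_card, Fintype.card_fin]; norm_num)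
    obtain ⟨σ, hσ, hne⟩ := hfix i
    exact hne (hi ⟨σ, hσ⟩)
  have hne6 : N.index ≠ 2 := by
    intro h
    have hsub : ∀ g : alternatingGroup (Fin 4), g ^ 3 = 1 → g ∈ N := by
      intro g hg
      have := Subgroup.sq_mem_of_index_two h (g ^ 2)
      rwa [← pow_mul, show 2 * 2 = 3 + 1 from rfl, pow_succ, hg, one_mul] at this
    have h9 : (Finset.univ.filter fun g : alternatingGroup (Fin 4) => g ^ 3 = 1).card = 9 := by
      decide +kernel
    have : Nat.card {g : alternatingGroup (Fin 4) // g ^ 3 = 1} ≤ Nat.card N :=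
      Nat.card_le_card_of_injective (fun g => (⟨g.1, hsub g.1 g.2⟩ : N))
        fun a b hab => Subtype.ext (by simpa using hab)
    rw [Nat.card_eq_fintype_card, Fintype.card_subtype, h9, hcard] at this
    rw [h] at hmul
    omega
  have h1 : N.index = 1 := by
    obtain ⟨k, hk⟩ := h3
    have hk4 : k * N.index = 4 := by
      rw [hk] at hmul
      linarith
    have hk4' : k ≤ 4 := Nat.le_of_dvd (by norm_num) (Dvd.intro _ hk4)
    interval_cases k <;> omega
  rw [Subgroup.index_eq_one, hN, Subgroup.subgroupOf_eq_top] at h1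
  exact le_antisymm hle h1

/-- The permutation representation on a family of elements stable under the Galois group. -/
theorem exists_permHom {K L ι : Type*} [Field K] [Field L] [Algebra K L] [Finite ι]
    {r : ι → L} (hr : Function.Injective r)
    (hperm : ∀ (σ : L ≃ₐ[K] L) (i : ι), ∃ j, σ (r i) = r j) :
    ∃ φ : (L ≃ₐ[K] L) →* Equiv.Perm ι, ∀ σ i, σ (r i) = r (φ σ i) := by
  choose f hf using hperm
  have hbij : ∀ σ, Function.Bijective (f σ) := fun σ =>
    Finite.injective_iff_bijective.1 fun i j hij =>
      hr (σ.injective (by rw [hf, hf, hij]))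
  refine ⟨MonoidHom.mk' (fun σ => Equiv.ofBijective (f σ) (hbij σ)) fun σ τ => ?_,
      fun σ i => hf σ i⟩
  ext i
  apply hr
  simp [← hf]

theorem nonempty_algEquiv_mulEquiv_alternatingGroup {K L : Type*} [Field K] [Field L] [Algebra K L]
    [CharZero L] [FiniteDimensional K L] [IsGalois K L] {r : Fin 4 → L}
    (hperm : ∀ (σ : L ≃ₐ[K] L) (i : Fin 4), ∃ j, σ (r i) = r j)
    (hgen : adjoin K (Set.range r) = ⊤)
    (hdisc : (Matrix.vandermonde r).det ∈ (algebraMap K L).range)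
    (hdisc0 : (Matrix.vandermonde r).det ≠ 0)
    (hfix : ∀ i, r i ∉ (algebraMap K L).range)
    (h3 : 3 ∣ Module.finrank K L) :
    Nonempty ((L ≃ₐ[K] L) ≃* alternatingGroup (Fin 4)) := by
  have hr : Function.Injective r := Matrix.det_vandermonde_ne_zero_iff.1 hdisc0
  obtain ⟨φ, hφ⟩ := exists_permHom hr hperm
  have hinj : Function.Injective φ := by
    rw [injective_iff_map_eq_one]
    intro σ hσ
    have hle : adjoin K (Set.range r) ≤ fixedField (Subgroup.zpowers σ) := by
      rw [adjoin_le_iff]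
      rintro _ ⟨i, rfl⟩
      rintro ⟨τ, n, rfl⟩
      have : σ ∈ MulAction.stabilizer (L ≃ₐ[K] L) (r i) := by
        change σ (r i) = r i
        rw [hφ, hσ, Equiv.Perm.one_apply]
      exact Subgroup.zpow_mem _ this n
    rw [hgen, top_le_iff] at hle
    ext x
    have hx : x ∈ fixedField (Subgroup.zpowers σ) := hle ▸ mem_top
    exact hx ⟨σ, Subgroup.mem_zpowers σ⟩
  have hrange : φ.range = alternatingGroup (Fin 4) := by
    apply Subgroup.eq_alternatingGroup_of_three_dvd_card
    · rintro _ ⟨σ, rfl⟩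
      rw [Equiv.Perm.mem_alternatingGroup]
      obtain ⟨d, hd⟩ := hdisc
      have h1 : σ (Matrix.vandermonde r).det = (Matrix.vandermonde r).det := by
        rw [← hd, AlgEquiv.commutes]
      have h2 : σ (Matrix.vandermonde r).det =
          (Equiv.Perm.sign (φ σ) : ℤ) * (Matrix.vandermonde r).det := by
        rw [← Matrix.det_permute, AlgEquiv.map_det]
        congr 1
        ext i j
        simp [Matrix.vandermonde_apply, hφ]
      rw [h1] at h2
      rcases Int.units_eq_one_or (Equiv.Perm.sign (φ σ)) with h | h
      · exact h
      · rw [h] at h2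
        exact absurd (by simpa [eq_neg_iff_add_eq_zero, ← two_mul] using h2) hdisc0
    · rwa [← Nat.card_congr (MonoidHom.ofInjective hinj).toEquiv, IsGalois.card_aut_eq_finrank]
    · intro i
      by_contra! h
      apply hfix i
      refine (IsGalois.mem_range_algebraMap_iff_fixed (F := K) (r i)).2 fun σ => ?_
      rw [hφ, h _ ⟨σ, rfl⟩]
  exact ⟨(MonoidHom.ofInjective hinj).trans (MulEquiv.subgroupCongr hrange)⟩

theorem coe_sqrt13 : (sqrt13 : ℝ) = Real.sqrt 13 := AdjoinSimple.coe_gen ..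

theorem sqrt13_sq : sqrt13 ^ 2 = 13 := by
  apply (algebraMap K13 ℝ).injective
  have h : algebraMap K13 ℝ sqrt13 = Real.sqrt 13 := coe_sqrt13
  rw [map_pow, map_ofNat, h, Real.sq_sqrt (by norm_num)]

theorem exists_eq_add_mul_sqrt13 (x : K13) : ∃ a b : ℚ, x = a + b * sqrt13 := by
  have hsqrt : IsIntegral ℚ (Real.sqrt 13) :=
    ⟨X ^ 2 - C 13, monic_X_pow_sub_C _ two_ne_zero, by simp⟩
  have key : ∀ y ∈ Algebra.adjoin ℚ {Real.sqrt 13}, ∃ a b : ℚ, y = a + b * Real.sqrt 13 := by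
    intro y hy
    induction hy using Algebra.adjoin_induction with
    | mem y hy => exact ⟨0, 1, by simpa using hy⟩
    | algebraMap q => exact ⟨q, 0, by simp⟩
    | add y z _ _ hy hz =>
      obtain ⟨a, b, rfl⟩ := hy
      obtain ⟨c, d, rfl⟩ := hz
      exact ⟨a + c, b + d, by push_cast; ring⟩
    | mul y z _ _ hy hz =>
      obtain ⟨a, b, rfl⟩ := hy
      obtain ⟨c, d, rfl⟩ := hz
      refine ⟨a * c + 13 * b * d, a * d + b * c, ?_⟩
      have h : Real.sqrt 13 ^ 2 = 13 := Real.sq_sqrt (by norm_num)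
      push_cast
      linear_combination (b * d : ℝ) * h
  obtain ⟨a, b, h⟩ := key x (by
    rw [← adjoin_simple_toSubalgebra_of_isAlgebraic hsqrt.isAlgebraic]
    exact x.2)
  exact ⟨a, b, Subtype.ext (by simpa [coe_sqrt13] using h)⟩

theorem add_mul_sqrt13_eq_zero {a b : ℚ} (h : (a : K13) + b * sqrt13 = 0) : a = 0 ∧ b = 0 := by
  have hR : (a : ℝ) + b * Real.sqrt 13 = 0 := by
    simpa [coe_sqrt13] using congrArg (Subtype.val) h
  have hirr : Irrational (Real.sqrt 13) := by
    simpa using Nat.Prime.irrational_sqrt (p := 13) (by norm_num)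
  have hb : b = 0 := by
    by_contra hb
    have hb' : (b : ℝ) ≠ 0 := by exact_mod_cast hb
    exact hirr ⟨-a / b, by push_cast; field_simp; linarith⟩
  subst hb
  exact ⟨by simpa using hR, rfl⟩

/-- Two rational numbers have a common denominator such that the resulting numerators and
denominator are not all divisible by a given integer `p > 1`. -/
theorem Rat.exists_common_den (a b : ℚ) {p : ℕ} (hp : 1 < p) :
    ∃ A B n : ℤ, (n : ℚ) ≠ 0 ∧ a * n = A ∧ b * n = B ∧ ¬ ((p : ℤ) ∣ A ∧ (p : ℤ) ∣ B ∧
        (p : ℤ) ∣ n) := by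
  classical
  have hex : ∃ n : ℕ, 0 < n ∧ ∃ A B : ℤ, a * n = A ∧ b * n = B := by
    refine ⟨a.den * b.den, Nat.mul_pos a.den_pos b.den_pos, a.num * b.den, b.num * a.den, ?_, ?_⟩
    · push_cast
      rw [← mul_assoc, Rat.mul_den_eq_num]
    · push_cast
      rw [mul_comm (a.den : ℚ), ← mul_assoc, Rat.mul_den_eq_num]
  obtain ⟨hpos, A, B, hA, hB⟩ := Nat.find_spec hex
  refine ⟨A, B, Nat.find hex, by exact_mod_cast hpos.ne', by exact_mod_cast hA,
    by exact_mod_cast hB, ?_⟩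
  rintro ⟨⟨A', hA'⟩, ⟨B', hB'⟩, hn⟩
  obtain ⟨m, hm⟩ := Int.natCast_dvd_natCast.1 hn
  rw [hm] at hA hB hpos
  have hp0 : (p : ℚ) ≠ 0 := by positivity
  have hmpos : 0 < m := Nat.pos_of_mul_pos_left hpos
  refine Nat.find_min hex (m := m) (by rw [hm]; nlinarith) ⟨hmpos, A', B', ?_, ?_⟩
  · apply mul_left_cancel₀ hp0
    rw [hA'] at hA
    push_cast at hA
    linarith
  · apply mul_left_cancel₀ hp0
    rw [hB'] at hB
    push_cast at hB
    linarith

/-- The cubic has no root in `K13` because it has none modulo the inert prime `7`. -/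
theorem resolvent_ne_zero (x : K13) :
    x ^ 3 + ((-436 + 16 * sqrt13) / 9) * x ^ 2 + ((9767 - 3896 * sqrt13) / 27) * x +
      ((-359390 + 585584 * sqrt13) / 729) ≠ 0 := by
  intro h
  obtain ⟨a, b, hx⟩ := exists_eq_add_mul_sqrt13 (9 * x)
  have hs := sqrt13_sq
  obtain ⟨hre, him⟩ := add_mul_sqrt13_eq_zero
    (a := a ^ 3 + 39 * a * b ^ 2 - 436 * (a ^ 2 + 13 * b ^ 2) + 416 * a * b + 29301 * a
      - 151944 * b - 359390)
    (b := 3 * a ^ 2 * b + 13 * b ^ 3 - 872 * a * b + 16 * (a ^ 2 + 13 * b ^ 2) + 29301 * b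
      - 11688 * a + 585584) (by
    obtain rfl : x = (a + b * sqrt13) / 9 := by rw [← hx]; field_simp
    push_cast
    linear_combination 729 * h - (3 * a * b ^ 2 + b ^ 3 * sqrt13 - 436 * b ^ 2 + 32 * a * b
      + 16 * b ^ 2 * sqrt13 - 11688 * b : K13) * hs)
  obtain ⟨A, B, n, hn, hA, hB, hdvd⟩ := Rat.exists_common_den a b (p := 7) (by norm_num)
  obtain rfl : a = A / n := by rw [← hA]; field_simp
  obtain rfl : b = B / n := by rw [← hB]; field_simp
  field_simp at hre him
  have hre' : A ^ 3 + 39 * A * B ^ 2 - 436 * (A ^ 2 + 13 * B ^ 2) * n + 416 * A * B * n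
      + 29301 * A * n ^ 2 - 151944 * B * n ^ 2 - 359390 * n ^ 3 = 0 := by
    have : (A ^ 3 + 39 * A * B ^ 2 - 436 * (A ^ 2 + 13 * B ^ 2) * n + 416 * A * B * n
      + 29301 * A * n ^ 2 - 151944 * B * n ^ 2 - 359390 * n ^ 3 : ℚ) = 0 := by
      linear_combination hre
    exact_mod_cast this
  have him' : 3 * A ^ 2 * B + 13 * B ^ 3 - 872 * A * B * n + 16 * (A ^ 2 + 13 * B ^ 2) * n
      + 29301 * B * n ^ 2 - 11688 * A * n ^ 2 + 585584 * n ^ 3 = 0 := by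
    have : (3 * A ^ 2 * B + 13 * B ^ 3 - 872 * A * B * n + 16 * (A ^ 2 + 13 * B ^ 2) * n
      + 29301 * B * n ^ 2 - 11688 * A * n ^ 2 + 585584 * n ^ 3 : ℚ) = 0 := by
      linear_combination him
    exact_mod_cast this
  have key : ∀ A B n : ZMod 7, A ^ 3 + 39 * A * B ^ 2 - 436 * (A ^ 2 + 13 * B ^ 2) * n
      + 416 * A * B * n + 29301 * A * n ^ 2 - 151944 * B * n ^ 2 - 359390 * n ^ 3 = 0 →
      3 * A ^ 2 * B + 13 * B ^ 3 - 872 * A * B * n + 16 * (A ^ 2 + 13 * B ^ 2) * n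
      + 29301 * B * n ^ 2 - 11688 * A * n ^ 2 + 585584 * n ^ 3 = 0 → A = 0 ∧ B = 0 ∧ n = 0 := by
    decide +kernel
  apply hdvd
  simp only [← ZMod.intCast_zmod_eq_zero_iff_dvd]
  apply key
  · exact_mod_cast congrArg (Int.cast : ℤ → ZMod 7) hre'
  · exact_mod_cast congrArg (Int.cast : ℤ → ZMod 7) him'

theorem quartic_ne_zero (x : K13) :
    x ^ 4 + 11 * x ^ 3 + ((436 - 16 * sqrt13) / 9) * x ^ 2 + ((3529 - 40 * sqrt13) / 27) * x +
      (269 + 32 * sqrt13) ≠ 0 := by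
  intro h
  have hR := congrArg (algebraMap K13 ℝ) h
  have hs : algebraMap K13 ℝ sqrt13 = Real.sqrt 13 := coe_sqrt13
  simp only [map_add, map_mul, map_pow, map_sub, map_div₀, map_ofNat, map_zero, hs] at hR
  generalize algebraMap K13 ℝ x = y at hR
  have hs2 : Real.sqrt 13 ^ 2 = 13 := Real.sq_sqrt (by norm_num)
  have hs0 := Real.sqrt_nonneg 13
  generalize Real.sqrt 13 = s at hR hs2 hs0
  have h1 : 3.6 < s := by nlinarith
  have h2 : s < 3.61 := by nlinarith
  set a := 655 / 36 - 16 / 9 * s with ha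
  set b := 3529 / 27 - 40 / 27 * s with hb
  have ha0 : 0 < a := by rw [ha]; linarith
  have hdisc : b ^ 2 < 4 * a * (269 + 32 * s) := by rw [ha, hb]; nlinarith
  have hquad : 0 < 4 * a * (a * y ^ 2 + b * y + (269 + 32 * s)) := by
    nlinarith [sq_nonneg (2 * a * y + b)]
  have := pos_of_mul_pos_right hquad (by positivity)
  rw [ha, hb] at this
  nlinarith [sq_nonneg (y ^ 2 + 11 / 2 * y)]

section Quartic

variable {L : Type*} [Field L]

theorem elementarySymmetric_of_eval_eq [CharZero L] {a b c d r₀ r₁ r₂ r₃ : L}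
    (h : ∀ y, y ^ 4 + a * y ^ 3 + b * y ^ 2 + c * y + d = (y - r₀) * (y - r₁) * (y - r₂) * (y -
        r₃)) :
    r₀ + r₁ + r₂ + r₃ = -a ∧
    r₀ * r₁ + r₀ * r₂ + r₀ * r₃ + r₁ * r₂ + r₁ * r₃ + r₂ * r₃ = b ∧
    r₀ * r₁ * r₂ + r₀ * r₁ * r₃ + r₀ * r₂ * r₃ + r₁ * r₂ * r₃ = -c ∧
    r₀ * r₁ * r₂ * r₃ = d := by
  refine ⟨?_, ?_, ?_, ?_⟩
  · linear_combination (h 2 - 3 * h 1 - h (-1) + 3 * h 0) / 6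
  · linear_combination h 0 - (h 1 + h (-1)) / 2
  · linear_combination (h 1 - h (-1)) / 2 - (h 2 - 3 * h 1 - h (-1) + 3 * h 0) / 6
  · linear_combination -h 0

theorem resolvent_eq_prod {e₁ e₂ e₃ e₄ r₀ r₁ r₂ r₃ : L} (h₁ : r₀ + r₁ + r₂ + r₃ = e₁)
    (h₂ : r₀ * r₁ + r₀ * r₂ + r₀ * r₃ + r₁ * r₂ + r₁ * r₃ + r₂ * r₃ = e₂)
    (h₃ : r₀ * r₁ * r₂ + r₀ * r₁ * r₃ + r₀ * r₂ * r₃ + r₁ * r₂ * r₃ = e₃)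
    (h₄ : r₀ * r₁ * r₂ * r₃ = e₄) (x : L) :
    x ^ 3 - e₂ * x ^ 2 + (e₁ * e₃ - 4 * e₄) * x - (e₁ ^ 2 * e₄ - 4 * e₂ * e₄ + e₃ ^ 2) =
      (x - (r₀ * r₁ + r₂ * r₃)) * (x - (r₀ * r₂ + r₁ * r₃)) * (x - (r₀ * r₃ + r₁ * r₂)) := by
  subst h₁ h₂ h₃ h₄
  ring

/-- The discriminant of a quartic is that of its resolvent cubic. -/
theorem det_vandermonde_sq {e₁ e₂ e₃ e₄ r₀ r₁ r₂ r₃ : L} (h₁ : r₀ + r₁ + r₂ + r₃ = e₁)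
    (h₂ : r₀ * r₁ + r₀ * r₂ + r₀ * r₃ + r₁ * r₂ + r₁ * r₃ + r₂ * r₃ = e₂)
    (h₃ : r₀ * r₁ * r₂ + r₀ * r₁ * r₃ + r₀ * r₂ * r₃ + r₁ * r₂ * r₃ = e₃)
    (h₄ : r₀ * r₁ * r₂ * r₃ = e₄) {B C D : L} (hB : B = -e₂) (hC : C = e₁ * e₃ - 4 * e₄)
    (hD : D = -(e₁ ^ 2 * e₄ - 4 * e₂ * e₄ + e₃ ^ 2)) :
    (Matrix.vandermonde ![r₀, r₁, r₂, r₃]).det ^ 2 =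
      B ^ 2 * C ^ 2 - 4 * C ^ 3 - 4 * B ^ 3 * D - 27 * D ^ 2 + 18 * B * C * D := by
  obtain ⟨t₀, ht₀⟩ : ∃ t, t = r₀ * r₁ + r₂ * r₃ := ⟨_, rfl⟩
  obtain ⟨t₁, ht₁⟩ : ∃ t, t = r₀ * r₂ + r₁ * r₃ := ⟨_, rfl⟩
  obtain ⟨t₂, ht₂⟩ : ∃ t, t = r₀ * r₃ + r₁ * r₂ := ⟨_, rfl⟩
  have hB' : B = -(t₀ + t₁ + t₂) := by subst_vars; ring
  have hC' : C = t₀ * t₁ + t₀ * t₂ + t₁ * t₂ := by subst_vars; ring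
  have hD' : D = -(t₀ * t₁ * t₂) := by subst_vars; ring
  have hdet : (Matrix.vandermonde ![r₀, r₁, r₂, r₃]).det =
      (r₁ - r₀) * (r₂ - r₀) * (r₃ - r₀) * (r₂ - r₁) * (r₃ - r₁) * (r₃ - r₂) := by
    have h₀ : Finset.Ioi (0 : Fin 4) = {1, 2, 3} := by decide
    have h₁ : Finset.Ioi (1 : Fin 4) = {2, 3} := by decide
    have h₂ : Finset.Ioi (2 : Fin 4) = {3} := by decide
    have h₃ : Finset.Ioi (3 : Fin 4) = ∅ := by decide
    rw [Matrix.det_vandermonde, Fin.prod_univ_four, h₀, h₁, h₂, h₃]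
    simp only [Matrix.cons_val, Finset.prod_empty, mul_one, Finset.prod_singleton,
      Finset.prod_insert (show (1 : Fin 4) ∉ ({2, 3} : Finset (Fin 4)) by decide),
      Finset.prod_insert (show (2 : Fin 4) ∉ ({3} : Finset (Fin 4)) by decide)]
    ring
  have h01 : t₀ - t₁ = (r₀ - r₃) * (r₁ - r₂) := by rw [ht₀, ht₁]; ring
  have h02 : t₀ - t₂ = (r₀ - r₂) * (r₁ - r₃) := by rw [ht₀, ht₂]; ring
  have h12 : t₁ - t₂ = (r₀ - r₁) * (r₂ - r₃) := by rw [ht₁, ht₂]; ring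
  calc _ = ((t₀ - t₁) * (t₀ - t₂) * (t₁ - t₂)) ^ 2 := by rw [hdet, h01, h02, h12]; ring
    _ = _ := by rw [hB', hC', hD']; ring

end Quartic

/-- The first quartic factor of `F14`, whose splitting field is that of `F14`. -/
noncomputable def quarticFactor : K13[X] :=
  X ^ 4 + C 11 * X ^ 3 + C ((436 - 16 * sqrt13) / 9) * X ^ 2 + C ((3529 - 40 * sqrt13) / 27) * X +
    C (269 + 32 * sqrt13)

/-- The resolvent cubic of `quarticFactor`. -/
noncomputable def resolventCubic : K13[X] :=
  X ^ 3 + C ((-436 + 16 * sqrt13) / 9) * X ^ 2 + C ((9767 - 3896 * sqrt13) / 27) * X +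
    C ((-359390 + 585584 * sqrt13) / 729)

theorem quarticFactor_natDegree : quarticFactor.natDegree = 4 := by
  unfold quarticFactor; compute_degree!

theorem quarticFactor_monic : quarticFactor.Monic := by
  unfold quarticFactor; monicity!

theorem resolventCubic_natDegree : resolventCubic.natDegree = 3 := by
  unfold resolventCubic; compute_degree!

theorem resolventCubic_monic : resolventCubic.Monic := by
  unfold resolventCubic; monicity!

theorem resolventCubic_irreducible : Irreducible resolventCubic := by
  apply irreducible_of_degree_le_three_of_not_isRoot
  · simp [resolventCubic_natDegree]
  · intro x hx
    apply resolvent_ne_zero x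
    simpa [resolventCubic] using hx

theorem F14_ne_zero : F14 ≠ 0 := by
  intro h
  have := congrArg (eval 0) h
  norm_num [F14, P13] at this

theorem quarticFactor_dvd_F14 : quarticFactor ∣ F14 := by
  refine ⟨(X ^ 4 + C ((43 + 5 * sqrt13) / 6) * X ^ 3 + C ((116 + 28 * sqrt13) / 3) * X ^ 2 +
    C ((1073 + 298 * sqrt13) / 9) * X + C ((48607 + 13481 * sqrt13) / 162)) *
    (X ^ 6 + C ((47 - 5 * sqrt13) / 6) * X ^ 5 + C ((232 - 73 * sqrt13) / 9) * X ^ 4 +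
    C ((2465 - 1553 * sqrt13) / 54) * X ^ 3 + C ((38419 + 935 * sqrt13) / 162) * X ^ 2 +
    C ((-27374 - 16423 * sqrt13) / 243) * X + C ((17743 - 4921 * sqrt13) / 1458)),
    Polynomial.funext fun x => ?_⟩
  simpa [F14, P13, j14, quarticFactor] using eval_factorization sqrt13_sq x

section SplittingField

variable {L : Type*} [Field L] [Algebra K13 L]

theorem algebraMap_sqrt13_sq : algebraMap K13 L sqrt13 ^ 2 = 13 := by
  rw [← map_pow, sqrt13_sq, map_ofNat]

theorem aeval_quarticFactor (y : L) :
    aeval y quarticFactor = y ^ 4 + 11 * y ^ 3 + ((436 - 16 * algebraMap K13 L sqrt13) / 9) * y ^ 2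
        +
      ((3529 - 40 * algebraMap K13 L sqrt13) / 27) * y + (269 + 32 * algebraMap K13 L sqrt13) := by
  simp [quarticFactor, aeval_C, map_ofNat]

theorem aeval_resolventCubic (y : L) :
    aeval y resolventCubic = y ^ 3 + ((-436 + 16 * algebraMap K13 L sqrt13) / 9) * y ^ 2 +
      ((9767 - 3896 * algebraMap K13 L sqrt13) / 27) * y +
      ((-359390 + 585584 * algebraMap K13 L sqrt13) / 729) := by
  simp [resolventCubic, aeval_C, map_ofNat]

theorem aeval_F14 (x : L) :
    aeval x F14 = (x ^ 2 + 5 * x + 13) * (x ^ 4 + 7 * x ^ 3 + 20 * x ^ 2 + 19 * x + 1) ^ 3 -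
      4096000 / 1594323 * (15996230 + 4436419 * algebraMap K13 L sqrt13) * x := by
  simp [F14, P13, j14, aeval_C, map_ofNat]

theorem exists_roots_quarticFactor (h : (quarticFactor.map (algebraMap K13 L)).Splits) :
    ∃ r₀ r₁ r₂ r₃ : L, ∀ y,
      aeval y quarticFactor = (y - r₀) * (y - r₁) * (y - r₂) * (y - r₃) := by
  have hcard := h.natDegree_eq_card_roots
  rw [natDegree_map, quarticFactor_natDegree] at hcard
  obtain ⟨r₀, r₁, r₂, r₃, hr⟩ := Multiset.card_eq_four.1 hcard.symm
  refine ⟨r₀, r₁, r₂, r₃, fun y => ?_⟩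
  rw [aeval_def, ← eval_map, h.eq_prod_roots_of_monic (quarticFactor_monic.map _), hr]
  simp [mul_assoc]

theorem three_dvd_finrank [FiniteDimensional K13 L] {θ : L} (h : aeval θ resolventCubic = 0) :
    3 ∣ Module.finrank K13 L := by
  rw [← resolventCubic_natDegree,
    minpoly.eq_of_irreducible_of_monic resolventCubic_irreducible h resolventCubic_monic]
  exact minpoly.degree_dvd (IsIntegral.of_finite K13 θ)

theorem aeval_resolventCubic_eq_prod {r₀ r₁ r₂ r₃ : L}
    (hr : ∀ y, aeval y quarticFactor = (y - r₀) * (y - r₁) * (y - r₂) * (y - r₃)) (x : L) :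
    aeval x resolventCubic =
      (x - (r₀ * r₁ + r₂ * r₃)) * (x - (r₀ * r₂ + r₁ * r₃)) * (x - (r₀ * r₃ + r₁ * r₂)) := by
  have : CharZero L := charZero_of_injective_algebraMap (algebraMap K13 L).injective
  obtain ⟨e₁, e₂, e₃, e₄⟩ := elementarySymmetric_of_eval_eq
    fun y => (aeval_quarticFactor y).symm.trans (hr y)
  rw [← resolvent_eq_prod e₁ e₂ e₃ e₄, aeval_resolventCubic]
  linear_combination (167488 / 729) * algebraMap_sqrt13_sq (L := L)

/-- Every root of `F14` is a polynomial expression in the roots of `quarticFactor`. -/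
theorem mem_of_aeval_F14_eq_zero {r₀ r₁ r₂ r₃ : L}
    (hr : ∀ y, aeval y quarticFactor = (y - r₀) * (y - r₁) * (y - r₂) * (y - r₃))
    (E : IntermediateField K13 L) (h₀ : r₀ ∈ E) (h₁ : r₁ ∈ E) (h₂ : r₂ ∈ E) (h₃ : r₃ ∈ E)
    {x : L} (hx : aeval x F14 = 0) : x ∈ E := by
  have : CharZero L := charZero_of_injective_algebraMap (algebraMap K13 L).injective
  have hs := algebraMap_sqrt13_sq (L := L)
  have hsE : algebraMap K13 L sqrt13 ∈ E := E.algebraMap_mem _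
  have hroot : ∀ y, aeval y quarticFactor = 0 → y ∈ E := by
    intro y hy
    rw [hr] at hy
    simp only [mul_eq_zero, sub_eq_zero] at hy
    rcases hy with ((rfl | rfl) | rfl) | rfl <;> assumption
  rw [aeval_F14, eval_factorization hs, mul_eq_zero, mul_eq_zero] at hx
  rcases hx with hx | hx | hx
  · exact hroot x (by rw [aeval_quarticFactor, hx])
  · obtain ⟨y, hy, rfl⟩ := exists_quartic_root_of_quartic_root hs hx
    have hyE : y ∈ E := hroot y (by rw [aeval_quarticFactor, hy])
    clear hroot
    apply_rules [add_mem, sub_mem, mul_mem, div_mem, pow_mem, neg_mem, ofNat_mem]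
  · obtain ⟨w, θ, hw, hθ, rfl⟩ := exists_resolvent_root_of_sextic_root hs hx
    clear hroot
    have hwE : w ∈ E := by
      obtain ⟨e₁, e₂, -, -⟩ := elementarySymmetric_of_eval_eq
        fun y => (aeval_quarticFactor y).symm.trans (hr y)
      have hθ' := aeval_resolventCubic_eq_prod hr θ
      rw [aeval_resolventCubic, hθ, eq_comm] at hθ'
      have hsq : ∀ {a b c d : L}, a + b + c + d = -11 →
          a * b + a * c + a * d + b * c + b * d + c * d =
            (436 - 16 * algebraMap K13 L sqrt13) / 9 →
          a ∈ E → b ∈ E → c ∈ E → d ∈ E → θ = a * b + c * d → w ∈ E := by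
        intro a b c d h₁ h₂ ha hb hc hd hθ
        have h : w ^ 2 = (a + b - c - d) ^ 2 := by
          rw [hw, hθ, ← h₂]
          linear_combination (11 - a - b - c - d) * h₁
        rcases sq_eq_sq_iff_eq_or_eq_neg.1 h with rfl | rfl
        · apply_rules [add_mem, sub_mem]
        · apply_rules [add_mem, sub_mem, neg_mem]
      simp only [mul_eq_zero, sub_eq_zero] at hθ'
      rcases hθ' with (h | h) | h
      · exact hsq e₁ e₂ h₀ h₁ h₂ h₃ h
      · exact hsq (by rw [← e₁]; ring) (by rw [← e₂]; ring) h₀ h₂ h₁ h₃ h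
      · exact hsq (by rw [← e₁]; ring) (by rw [← e₂]; ring) h₀ h₃ h₁ h₂ h
    apply_rules [add_mem, sub_mem, mul_mem, div_mem, pow_mem, neg_mem, ofNat_mem] <;>
      apply_rules [add_mem, sub_mem, mul_mem, div_mem, pow_mem, neg_mem, ofNat_mem]

theorem det_vandermonde_roots_sq {r₀ r₁ r₂ r₃ : L}
    (hr : ∀ y, aeval y quarticFactor = (y - r₀) * (y - r₁) * (y - r₂) * (y - r₃)) :
    (Matrix.vandermonde ![r₀, r₁, r₂, r₃]).det ^ 2 =
      algebraMap K13 L ((10930660 + 3056300 * sqrt13) / 729) ^ 2 := by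
  have : CharZero L := charZero_of_injective_algebraMap (algebraMap K13 L).injective
  have hs := algebraMap_sqrt13_sq (L := L)
  obtain ⟨e₁, e₂, e₃, e₄⟩ := elementarySymmetric_of_eval_eq
    fun y => (aeval_quarticFactor y).symm.trans (hr y)
  rw [det_vandermonde_sq e₁ e₂ e₃ e₄ rfl rfl rfl]
  simp only [map_div₀, map_add, map_mul, map_ofNat]
  generalize algebraMap K13 L sqrt13 = s at hs
  linear_combination ((-2963348157328 - 2242848065536 * s - 392575791104 * s ^ 2 +
    2744123392 * s ^ 3) / 531441) * hs

end SplittingField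

/-- The Galois group over `K = ℚ(√13)` of `F(X) = P(X) − j·X`, where
`j = (4096000/1594323)·(15996230 + 4436419·√13)`, is isomorphic to the
alternating group `A₄`. -/
theorem gal_F14_iso_A4 : Nonempty (F14.Gal ≃* alternatingGroup (Fin 4)) := by
  have : IsGalois K13 F14.SplittingField :=
    { to_isSeparable := inferInstance
      to_normal := Normal.of_isSplittingField F14 }
  obtain ⟨r₀, r₁, r₂, r₃, hr⟩ := exists_roots_quarticFactor (L := F14.SplittingField)
    ((SplittingField.splits F14).of_dvd (map_ne_zero F14_ne_zero)
      (map_dvd (algebraMap K13 F14.SplittingField) quarticFactor_dvd_F14))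
  have hroot : ∀ i, aeval (![r₀, r₁, r₂, r₃] i) quarticFactor = 0 := by
    intro i
    rw [hr]
    fin_cases i <;> simp
  have hdet := det_vandermonde_roots_sq hr
  have hd : ((10930660 + 3056300 * sqrt13) / 729 : K13) ≠ 0 := by
    intro h
    have := (add_mul_sqrt13_eq_zero (a := 10930660 / 729) (b := 3056300 / 729)
      (by push_cast; linear_combination h)).1
    norm_num at this
  refine nonempty_algEquiv_mulEquiv_alternatingGroup (r := ![r₀, r₁, r₂, r₃]) ?_ ?_ ?_ ?_ ?_ ?_
  · intro σ i
    have h : aeval (σ (![r₀, r₁, r₂, r₃] i)) quarticFactor = 0 := by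
      rw [aeval_algHom_apply, hroot, map_zero]
    rw [hr] at h
    simp only [mul_eq_zero, sub_eq_zero] at h
    rcases h with ((h | h) | h) | h
    exacts [⟨0, h⟩, ⟨1, h⟩, ⟨2, h⟩, ⟨3, h⟩]
  · have hmem : ∀ i, ![r₀, r₁, r₂, r₃] i ∈ adjoin K13 (Set.range ![r₀, r₁, r₂, r₃]) :=
      fun i => subset_adjoin _ _ ⟨i, rfl⟩
    rw [eq_top_iff, ← toSubalgebra_le_toSubalgebra, top_toSubalgebra,
      ← SplittingField.adjoin_rootSet, Algebra.adjoin_le_iff]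
    intro x hx
    exact mem_of_aeval_F14_eq_zero hr _ (hmem 0) (hmem 1) (hmem 2) (hmem 3)
      (mem_rootSet.1 hx).2
  · rcases sq_eq_sq_iff_eq_or_eq_neg.1 hdet with h | h
    · exact ⟨_, h.symm⟩
    · exact ⟨-_, by rw [map_neg, h]⟩
  · intro h
    rw [h, zero_pow two_ne_zero, eq_comm, pow_eq_zero_iff two_ne_zero, map_eq_zero] at hdet
    exact hd hdet
  · rintro i ⟨x, hx⟩
    have h := hroot i
    rw [← hx, aeval_algebraMap_apply, map_eq_zero, aeval_quarticFactor] at h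
    exact quartic_ne_zero x h
  · exact three_dvd_finrank (θ := r₀ * r₁ + r₂ * r₃) (by
      rw [aeval_resolventCubic_eq_prod hr, sub_self, zero_mul, zero_mul])
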